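/- Let a, b : ℤ → ℝ, neither identically zero, with the Hurwitz-type matrix H(a,b) totally nonnegative. Suppose there exists K ∈ ℤ with b_k > 0 for all k ≤ K, and that b_k / b_{k+1} → r as k → −∞ for some real r > 0 (so r > 0 is the inner radius of convergence of the Laurent series). Define a″_k = a_k − r·a_{k+1} and b″_k = b_k − r·b_{k+1} for k ∈ ℤ (the coefficient sequences of (1 − r/z)p(z) and (1 − r/z)q(z)). Then the Hurwitz-type matrix H(a″, b″) is totally nonnegative. -/

import Mathlib

/-- A doubly infinite real matrix is totally nonnegative if all its minors
(with rows and columns selected in increasing order) are nonnegative. -/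
def TotallyNonneg (M : ℤ → ℤ → ℝ) : Prop :=
  ∀ (k : ℕ) (i j : Fin k → ℤ), StrictMono i → StrictMono j →
    0 ≤ (Matrix.of fun r s => M (i r) (j s)).det

/-- The doubly infinite Hurwitz-type matrix of two sequences `a b : ℤ → ℝ`:
row `2m` is `j ↦ a (j - m)` and row `2m+1` is `j ↦ b (j - m)`. -/
def hurwitz (a b : ℤ → ℝ) : ℤ → ℤ → ℝ :=
  fun i j => if 2 ∣ i then a (j - i / 2) else b (j - (i - 1) / 2)

/-- Total nonnegativity of a matrix whose rows and columns are indexed by arbitrary preorders. -/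
def MinorsNonneg {R C : Type*} [Preorder R] [Preorder C] (A : R → C → ℝ) : Prop :=
  ∀ (k : ℕ) (i : Fin k → R) (j : Fin k → C), StrictMono i → StrictMono j →
    0 ≤ (Matrix.of fun r s => A (i r) (j s)).det

/-- A three-term Plücker relation for determinants sharing all columns but two. -/
theorem det_mul_det_updateCol_updateCol {n K : Type*} [Fintype n] [DecidableEq n] [CommRing K]
    (N : Matrix n n K) {s t : n} (hst : s ≠ t) (v w : n → K) :
    N.det * ((N.updateCol s v).updateCol t w).det =
      (N.updateCol s w).det * ((N.updateCol s v).updateCol t (N.col s)).det +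
        (N.updateCol t w).det * (N.updateCol s v).det := by
  have hw : N.det • w = ∑ u, (N.updateCol u w).det • N.col u := by
    rw [← Matrix.mulVec_cramer]
    ext x
    simp [Matrix.mulVec, dotProduct, Matrix.cramer_apply, mul_comm]
  have h1 : N.det * ((N.updateCol s v).updateCol t w).det =
      ∑ u, (N.updateCol u w).det * ((N.updateCol s v).updateCol t (N.col u)).det := by
    simp only [← Matrix.cramer_apply]
    simp only [← Matrix.cramer_apply] at hw
    rw [← smul_eq_mul, ← Pi.smul_apply, ← map_smul, hw, map_sum, Finset.sum_apply]
    simp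
  rw [h1, ← Finset.sum_subset (Finset.subset_univ {s, t}), Finset.sum_pair hst]
  · congr 3
    ext x y
    by_cases hy : y = t
    · subst hy; simp [Matrix.updateCol_ne hst.symm]
    · simp [Matrix.updateCol_ne hy]
  · intro u _ hu
    simp only [Finset.mem_insert, Finset.mem_singleton, not_or] at hu
    rw [Matrix.det_zero_of_column_eq (M := (N.updateCol s v).updateCol t (N.col u)) hu.2, mul_zero]
    intro x
    simp [Matrix.updateCol_ne hu.2, Matrix.updateCol_ne hu.1]

theorem det_updateCol_single {n : ℕ} (M : Matrix (Fin (n + 1)) (Fin (n + 1)) ℝ)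
    (i j : Fin (n + 1)) :
    (M.updateCol j (Pi.single i 1)).det =
      (-1) ^ (i + j : ℕ) * (M.submatrix i.succAbove j.succAbove).det := by
  rw [← Matrix.cramer_apply, Matrix.cramer_eq_adjugate_mulVec, Matrix.mulVec_single_one,
    Matrix.col_apply, Matrix.adjugate_fin_succ_eq_det_submatrix]

theorem StrictMono.update_of_lt {ι α : Type*} [LinearOrder ι] [Preorder α] {f : ι → α}
    (hf : StrictMono f) (a : ι) (x : α) (h1 : ∀ b < a, f b < x) (h2 : ∀ b, a < b → x < f b) :
    StrictMono (Function.update f a x) := by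
  intro b c hbc
  by_cases hb : b = a
  · subst hb
    simpa [hbc.ne'] using h2 c hbc
  · by_cases hc : c = a
    · subst hc
      simpa [hb] using h1 b hbc
    · simpa [hb, hc] using hf hbc

theorem of_update_eq_updateCol {ι κ R C : Type*} [DecidableEq κ] (A : R → C → ℝ) (i : ι → R)
    (j : κ → C) (a : κ) (x : C) :
    (Matrix.of fun r s => A (i r) (Function.update j a x s)) =
      (Matrix.of fun r s => A (i r) (j s)).updateCol a (fun r => A (i r) x) := by
  ext r s
  by_cases h : s = a
  · subst h; simp
  · simp [h]

/-- Comparison of minors obtained by moving column `p` to `p + 1`; it reduces to the case where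
`p` is the last column. -/
theorem MinorsNonneg.mul_det_update_le {R : Type*} [Preorder R] {A : R → ℕ → ℝ}
    (hA : MinorsNonneg A) {p : ℕ} {r : ℝ}
    (hlast : ∀ (n : ℕ) (i : Fin (n + 1) → R) (j : Fin (n + 1) → ℕ), StrictMono i → StrictMono j →
      j (Fin.last n) = p →
      r * (Matrix.of fun u s => A (i u) (Function.update j (Fin.last n) (p + 1) s)).det ≤
        (Matrix.of fun u s => A (i u) (j s)).det) :
    ∀ (n : ℕ) (i : Fin n → R) (j : Fin n → ℕ) (a : Fin n), StrictMono i → StrictMono j →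
      j a = p → (∀ s, j s ≠ p + 1) →
      r * (Matrix.of fun u s => A (i u) (Function.update j a (p + 1) s)).det ≤
        (Matrix.of fun u s => A (i u) (j s)).det := by
  intro n
  induction n with
  | zero => exact fun _ _ a => a.elim0
  | succ n ih =>
  intro i j a hi hj hja hjp
  induction a using Fin.lastCases with
  | last => exact hlast n i j hi hj hja
  | cast a =>
  have hne : a.castSucc ≠ a.succ := a.castSucc_lt_succ.ne
  have hlt : p + 1 < j a.succ := by
    have h1 := hj a.castSucc_lt_succ
    have h2 := hjp a.succ
    omega
  set j' := Function.update j a.castSucc (p + 1) with hj'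
  have hj'mono : StrictMono j' := by
    refine hj.update_of_lt _ _ (fun b hb => ?_) (fun b hb => ?_)
    · have := hj hb; omega
    · have := hj.monotone (Fin.castSucc_lt_iff_succ_le.1 hb); omega
  have hcomp : j' ∘ a.succ.succAbove = Function.update (j ∘ a.succ.succAbove) a (p + 1) := by
    ext s
    by_cases h : s = a
    · subst h; simp [hj']
    · have : a.succ.succAbove s ≠ a.castSucc := by
        intro h'
        apply h
        apply Fin.succAbove_right_injective (p := a.succ)
        simpa using h'
      simp [hj', h, this]
  set M := Matrix.of fun u s => A (i u) (j' s) with hM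
  have hsub (x : Fin (n + 1)) : M.submatrix x.succAbove a.succ.succAbove =
      Matrix.of fun u s => A ((i ∘ x.succAbove) u) ((j' ∘ a.succ.succAbove) s) := rfl
  have hmono (x : Fin (n + 1)) : StrictMono (i ∘ x.succAbove) :=
    hi.comp (Fin.strictMono_succAbove x)
  have hmin (x : Fin (n + 1)) : 0 ≤ (M.submatrix x.succAbove a.succ.succAbove).det := by
    rw [hsub]
    exact hA _ _ _ (hmono x) (hj'mono.comp (Fin.strictMono_succAbove _))
  by_cases hz : ∀ x : Fin (n + 1), (M.submatrix x.succAbove a.succ.succAbove).det = 0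
  · have : M.det = 0 := by
      rw [Matrix.det_succ_column M a.succ]
      simp [hz]
    rw [this, mul_zero]
    exact hA _ _ _ hi hj
  push Not at hz
  obtain ⟨x, hx⟩ := hz
  have hxpos := lt_of_le_of_ne (hmin x) hx.symm
  set c : ℕ → Fin (n + 1) → ℝ := fun q u => A (i u) q with hc
  have hP := det_mul_det_updateCol_updateCol (M.updateCol a.succ (Pi.single x 1)) hne
    (c p) (c (j a.succ))
  set ε : ℝ := (-1) ^ (x + a.succ : ℕ) with hε
  have hε0 : ε ≠ 0 := by simp [hε]
  set B := Matrix.of fun u s => A (i u) (j s) with hB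
  have hMB : M = B.updateCol a.castSucc (c (p + 1)) := by
    rw [hM, hj', of_update_eq_updateCol]
  have hBc : B.updateCol a.castSucc (c p) = B := by
    rw [hB, hc, ← of_update_eq_updateCol, ← hja, Function.update_eq_self]
  have hMp : M.updateCol a.castSucc (c p) = B := by
    rw [hMB, Matrix.updateCol_idem, hBc]
  have hBl : B.updateCol a.succ (c (j a.succ)) = B := by
    rw [hB, hc, ← of_update_eq_updateCol, Function.update_eq_self]
  have hMl : M.updateCol a.succ (c (j a.succ)) = M := by
    rw [hMB, Matrix.updateCol_comm _ hne, hBl]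
  have hcol : (M.updateCol a.succ (Pi.single x 1)).col a.castSucc = c (p + 1) := by
    ext u
    simp [Matrix.updateCol_ne hne, hMB]
  have hcomm (q : ℕ) : (M.updateCol a.succ (Pi.single x 1)).updateCol a.castSucc (c q) =
      (M.updateCol a.castSucc (c q)).updateCol a.succ (Pi.single x 1) :=
    Matrix.updateCol_comm M hne.symm _ _
  simp only [hcol, hcomm, Matrix.updateCol_idem, hMp, hMl, hBl, det_updateCol_single, ← hε] at hP
  have h1 : 0 ≤ ((M.updateCol a.castSucc (c (j a.succ))).submatrix
      x.succAbove a.succ.succAbove).det := by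
    have : (M.updateCol a.castSucc (c (j a.succ))).submatrix x.succAbove a.succ.succAbove =
        Matrix.of fun u s => A ((i ∘ x.succAbove) u) ((j ∘ a.castSucc.succAbove) s) := by
      ext u s
      rw [hMB, Matrix.updateCol_idem, hB, hc, ← of_update_eq_updateCol]
      simp only [Matrix.submatrix_apply, Matrix.of_apply, Function.comp]
      congr 1
      by_cases h : s = a
      · subst h; simp
      · have : a.succ.succAbove s = a.castSucc.succAbove s := by
          rcases lt_or_gt_of_ne h with h | h
          · rw [Fin.succAbove_of_castSucc_lt, Fin.succAbove_of_castSucc_lt] <;>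
              simp only [Fin.lt_def, Fin.val_castSucc, Fin.val_succ] <;> omega
          · rw [Fin.succAbove_of_le_castSucc, Fin.succAbove_of_le_castSucc] <;>
              simp only [Fin.le_def, Fin.val_castSucc, Fin.val_succ] <;> omega
        rw [this, Function.update_of_ne (Fin.succAbove_ne _ _)]
    rw [this]
    exact hA _ _ _ (hmono x) (hj.comp (Fin.strictMono_succAbove _))
  have h2 : 0 ≤ (B.updateCol a.succ (c (p + 1))).det := by
    rw [hB, hc, ← of_update_eq_updateCol]
    refine hA _ _ _ hi (hj.update_of_lt _ _ (fun b hb => ?_) (fun b hb => ?_))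
    · have := hj.monotone (Fin.le_castSucc_iff.2 hb); omega
    · have := hj hb; omega
  have h3 := ih (i ∘ x.succAbove) (j ∘ a.succ.succAbove) a (hmono x)
    (hj.comp (Fin.strictMono_succAbove _)) (by simpa using hja) (fun s => hjp _)
  rw [← hcomp, ← hsub] at h3
  have hM0 : 0 ≤ M.det := hA _ _ _ hi hj'mono
  have hBsub : B.submatrix x.succAbove a.succ.succAbove =
      Matrix.of fun u s => A ((i ∘ x.succAbove) u) ((j ∘ a.succ.succAbove) s) := rfl
  rw [← hBsub] at h3
  have h4 := mul_nonneg h1 h2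
  have h5 := mul_le_mul_of_nonneg_left h3 hM0
  refine le_of_mul_le_mul_left ?_ hxpos
  have hP' : (M.submatrix x.succAbove a.succ.succAbove).det * B.det =
      ((M.updateCol a.castSucc (c (j a.succ))).submatrix x.succAbove a.succ.succAbove).det *
          (B.updateCol a.succ (c (p + 1))).det +
        M.det * (B.submatrix x.succAbove a.succ.succAbove).det :=
    mul_left_cancel₀ hε0 (by linear_combination hP)
  linear_combination h5 + h4 - hP'

/-- When the top row vanishes left of column `p`, the comparison of minors holds if `p` is the
last column. -/
theorem MinorsNonneg.mul_det_update_last_le {R : Type*} [PartialOrder R] [OrderTop R]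
    {A : R → ℕ → ℝ} (hA : MinorsNonneg A) {p : ℕ} {r : ℝ} (h0 : ∀ q < p, A ⊤ q = 0)
    (hp : A ⊤ p = r * A ⊤ (p + 1)) (hpos : 0 < A ⊤ (p + 1))
    (n : ℕ) (i : Fin (n + 1) → R) (j : Fin (n + 1) → ℕ) (hi : StrictMono i) (hj : StrictMono j)
    (hjp : j (Fin.last n) = p) :
    r * (Matrix.of fun u s => A (i u) (Function.update j (Fin.last n) (p + 1) s)).det ≤
      (Matrix.of fun u s => A (i u) (j s)).det := by
  have hz (s : Fin n) : A ⊤ (j s.castSucc) = 0 := h0 _ (hjp ▸ hj (Fin.castSucc_lt_last s))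
  have hs (s : Fin n) : Function.update j (Fin.last n) (p + 1) s.castSucc = j s.castSucc :=
    Function.update_of_ne (Fin.castSucc_lt_last s).ne _ _
  by_cases hl : i (Fin.last n) = ⊤
  · rw [Matrix.det_succ_row _ (Fin.last n), Matrix.det_succ_row _ (Fin.last n),
      Fin.sum_univ_castSucc, Fin.sum_univ_castSucc]
    simp only [Matrix.of_apply, hl, hs, hz, hjp, hp, Function.update_self]
    apply le_of_eq
    have : (Matrix.of fun u s => A (i u) (Function.update j (Fin.last n) (p + 1) s)).submatrix
          (Fin.last n).succAbove (Fin.last n).succAbove =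
        (Matrix.of fun u s => A (i u) (j s)).submatrix
          (Fin.last n).succAbove (Fin.last n).succAbove := by
      ext u s
      simp
    rw [this]
    simp
    ring
  · have hi' : StrictMono (Fin.snoc i ⊤ : Fin (n + 2) → R) := by
      intro u v huv
      induction v using Fin.lastCases with
      | last =>
        induction u using Fin.lastCases with
        | last => exact absurd huv (lt_irrefl _)
        | cast u =>
          simp only [Fin.snoc_castSucc, Fin.snoc_last]
          exact (hi.monotone (Fin.le_last u)).trans_lt (lt_top_iff_ne_top.2 hl)
      | cast v =>
        induction u using Fin.lastCases with
        | last => exact absurd huv (not_lt.2 (Fin.le_last _))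
        | cast u => simpa using hi (by simpa using huv)
    have hj' : StrictMono (Fin.snoc j (p + 1) : Fin (n + 2) → ℕ) := by
      intro u v huv
      induction v using Fin.lastCases with
      | last =>
        induction u using Fin.lastCases with
        | last => exact absurd huv (lt_irrefl _)
        | cast u =>
          have := hj.monotone (Fin.le_last u)
          simp only [Fin.snoc_castSucc, Fin.snoc_last]
          omega
      | cast v =>
        induction u using Fin.lastCases with
        | last => exact absurd huv (not_lt.2 (Fin.le_last _))
        | cast u => simpa using hj (by simpa using huv)
    have hdet := hA _ _ _ hi' hj'
    rw [Matrix.det_succ_row _ (Fin.last (n + 1)), Fin.sum_univ_castSucc,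
      Fin.sum_univ_castSucc] at hdet
    have e1 : (Matrix.of fun u s => A ((Fin.snoc i ⊤ : Fin (n + 2) → R) u)
          ((Fin.snoc j (p + 1) : Fin (n + 2) → ℕ) s)).submatrix
          (Fin.last (n + 1)).succAbove (Fin.last (n + 1)).succAbove =
        Matrix.of fun u s => A (i u) (j s) := by
      ext u s
      simp
    have e2 : (Matrix.of fun u s => A ((Fin.snoc i ⊤ : Fin (n + 2) → R) u)
          ((Fin.snoc j (p + 1) : Fin (n + 2) → ℕ) s)).submatrix
          (Fin.last (n + 1)).succAbove (Fin.last n).castSucc.succAbove =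
        Matrix.of fun u s => A (i u) (Function.update j (Fin.last n) (p + 1) s) := by
      ext u s
      induction s using Fin.lastCases with
      | last => simp
      | cast s =>
        have : (Fin.last n).castSucc.succAbove s.castSucc = s.castSucc.castSucc :=
          Fin.succAbove_of_castSucc_lt _ _ (by simp [Fin.lt_def])
        simp [this]
    rw [e1, e2] at hdet
    simp only [Matrix.of_apply, Fin.snoc_castSucc, Fin.snoc_last, hz, hjp, hp, Fin.val_last,
      Fin.val_castSucc, mul_zero, zero_mul, Finset.sum_const_zero, zero_add] at hdet
    rw [show n + 1 + n = 2 * n + 1 by ring, show n + 1 + (n + 1) = 2 * (n + 1) by ring, pow_succ,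
      pow_mul, pow_mul] at hdet
    refine le_of_mul_le_mul_left ?_ hpos
    norm_num at hdet
    linarith

/-- One step of Neville elimination on columns preserves total nonnegativity. -/
theorem MinorsNonneg.eliminate {R : Type*} [PartialOrder R] [OrderTop R]
    {A : R → ℕ → ℝ} (hA : MinorsNonneg A) {p : ℕ} {r : ℝ} (h0 : ∀ q < p, A ⊤ q = 0)
    (hp : A ⊤ p = r * A ⊤ (p + 1)) (hpos : 0 < A ⊤ (p + 1)) :
    MinorsNonneg fun i => Function.update (A i) p (A i p - r * A i (p + 1)) := by
  intro k i j hi hj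
  by_cases h : ∃ a, j a = p
  swap
  · push Not at h
    simpa [h] using hA k i j hi hj
  obtain ⟨a, ha⟩ := h
  have hmat : (Matrix.of fun u s =>
      Function.update (A (i u)) p (A (i u) p - r * A (i u) (p + 1)) (j s)) =
      (Matrix.of fun u s => A (i u) (j s)).updateCol a
        ((fun u => A (i u) p) + (-r) • (fun u => A (i u) (p + 1))) := by
    ext u s
    by_cases hs : s = a
    · subst hs
      simp [ha]
      ring
    · have : j s ≠ p := fun h' => hs (hj.injective (h'.trans ha.symm))
      simp [this, hs]
  rw [hmat, Matrix.det_updateCol_add, Matrix.det_updateCol_smul, ← of_update_eq_updateCol,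
    ← of_update_eq_updateCol, ← ha, Function.update_eq_self, ha]
  by_cases h1 : ∃ s, j s = p + 1
  · obtain ⟨s, hs⟩ := h1
    have hne : a ≠ s := by
      rintro rfl
      omega
    have : (Matrix.of fun u s => A (i u) (Function.update j a (p + 1) s)).det = 0 :=
      Matrix.det_zero_of_column_eq hne fun u => by simp [hne.symm, hs]
    rw [this, mul_zero, add_zero]
    exact hA k i j hi hj
  · push Not at h1
    have := hA.mul_det_update_le (hA.mul_det_update_last_le h0 hp hpos) k i j a hi hj ha h1
    linarith

/-- If the top row is geometric with ratio `r⁻¹`, then the total nonnegativity passes to the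
matrix of differences of consecutive columns. -/
theorem MinorsNonneg.sub_mul_succ {R : Type*} [PartialOrder R] [OrderTop R]
    {A : R → ℕ → ℝ} (hA : MinorsNonneg A) {r : ℝ} (hr : ∀ q, A ⊤ q = r * A ⊤ (q + 1))
    (hpos : ∀ q, 0 < A ⊤ q) : MinorsNonneg fun i q => A i q - r * A i (q + 1) := by
  have key (p : ℕ) : MinorsNonneg fun i q => if q < p then A i q - r * A i (q + 1) else A i q := by
    induction p with
    | zero => simpa using hA
    | succ p ih =>
      convert ih.eliminate (p := p) (r := r) (fun q hq => ?_) ?_ ?_ using 1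
      · ext i q
        rcases lt_trichotomy q p with h | h | h
        · simp [h, h.ne, Nat.lt_succ_of_lt h]
        · simp [h]
        · simp [h.ne', h.not_gt, show ¬ q < p + 1 by omega]
      · simp [hq, ← hr q]
      · simpa using hr p
      · simpa using hpos (p + 1)
  intro k i j hi hj
  obtain ⟨p, hp⟩ := (Set.finite_range j).bddAbove
  have h := key (p + 1) k i j hi hj
  have hlt (s : Fin k) : j s < p + 1 := Nat.lt_succ_of_le (hp ⟨s, rfl⟩)
  simpa [hlt] using h

theorem MinorsNonneg.of_tendsto {R C X : Type*} [Preorder R] [Preorder C] {l : Filter X} [l.NeBot]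
    {F : X → R → C → ℝ} {A : R → C → ℝ} (hF : ∀ᶠ x in l, MinorsNonneg (F x))
    (h : ∀ i j, Filter.Tendsto (fun x => F x i j) l (nhds (A i j))) : MinorsNonneg A := by
  intro k i j hi hj
  have hlim : Filter.Tendsto (fun x => (Matrix.of fun u s => F x (i u) (j s)).det) l
      (nhds (Matrix.of fun u s => A (i u) (j s)).det) :=
    ((continuous_id.matrix_det).tendsto _).comp
      (tendsto_pi_nhds.2 fun u => tendsto_pi_nhds.2 fun s => h (i u) (j s))
  exact ge_of_tendsto hlim (hF.mono fun x hx => hx k i j hi hj)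

theorem MinorsNonneg.mul_comp {R R' C C' : Type*} [Preorder R] [Preorder C] [Preorder R']
    [Preorder C'] {A : R → C → ℝ} (hA : MinorsNonneg A) {f : R' → R} {g : C' → C}
    (hf : StrictMono f) (hg : StrictMono g) {c : R' → ℝ} (hc : ∀ i, 0 ≤ c i) :
    MinorsNonneg fun i j => c i * A (f i) (g j) := by
  intro k i j hi hj
  have := Matrix.det_mul_column (fun u => c (i u)) (Matrix.of fun u s => A (f (i u)) (g (j s)))
  simp only [Matrix.of_apply] at this
  rw [this]
  exact mul_nonneg (Finset.prod_nonneg fun _ _ => hc _) (hA k _ _ (hf.comp hi) (hg.comp hj))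

theorem hurwitz_sub_mul (a b : ℤ → ℝ) (r : ℝ) (i j : ℤ) :
    hurwitz (fun k => a k - r * a (k + 1)) (fun k => b k - r * b (k + 1)) i j =
      hurwitz a b i j - r * hurwitz a b i (j + 1) := by
  unfold hurwitz
  split_ifs <;> ring_nf

theorem hurwitz_odd (a b : ℤ → ℝ) (m j : ℤ) : hurwitz a b (2 * m + 1) j = b (j - m) := by
  have h : ¬ (2 : ℤ) ∣ 2 * m + 1 := by omega
  simp [hurwitz, h]

theorem tendsto_div_atBot_of_ratio {b : ℤ → ℝ} {K : ℤ} (hK : ∀ k ≤ K, 0 < b k) {r : ℝ}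
    (hr : 0 < r)
    (hlim : Filter.Tendsto (fun k : ℤ => b k / b (k + 1)) Filter.atBot (nhds r)) (c : ℕ) :
    Filter.Tendsto (fun k : ℤ => b (k + c) / b k) Filter.atBot (nhds (r⁻¹ ^ c)) := by
  induction c with
  | zero =>
    refine Filter.Tendsto.congr' ?_ tendsto_const_nhds
    filter_upwards [Filter.eventually_le_atBot K] with k hk
    simp [(hK k hk).ne']
  | succ c ih =>
    have h := (hlim.inv₀ hr.ne').comp
      (Filter.tendsto_atBot_add_const_right Filter.atBot (c : ℤ) Filter.tendsto_id)
    rw [pow_succ]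
    refine (ih.mul h).congr' ?_
    filter_upwards [Filter.eventually_le_atBot (K - c - 1)] with k hk
    have h1 := (hK k (by omega)).ne'
    have h2 := (hK (k + c) (by omega)).ne'
    simp only [Function.comp, id, inv_div, Nat.cast_succ, ← add_assoc]
    field_simp

theorem stmt10 (a b : ℤ → ℝ) (ha : ∃ n, a n ≠ 0) (hb : ∃ n, b n ≠ 0)
    (hH : TotallyNonneg (hurwitz a b))
    (K : ℤ) (hK : ∀ k : ℤ, k ≤ K → 0 < b k)
    (r : ℝ) (hr : 0 < r)
    (hlim : Filter.Tendsto (fun k : ℤ => b k / b (k + 1)) Filter.atBot (nhds r)) :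
    TotallyNonneg (hurwitz (fun k => a k - r * a (k + 1)) (fun k => b k - r * b (k + 1))) := by
  intro k i j hi hj
  obtain ⟨d, hd⟩ := (Set.finite_range j).bddBelow
  obtain ⟨e, he⟩ := (Set.finite_range i).bddAbove
  have hH' : MinorsNonneg (hurwitz a b) := hH
  let A : Fin (k + 1) → ℕ → ℝ :=
    Fin.snoc (fun u c => hurwitz a b (i u) (d + c)) (fun c => r⁻¹ ^ c)
  have hA : MinorsNonneg A := by
    let row : ℤ → Fin (k + 1) → ℤ := fun x => Fin.snoc i (2 * (d - x) + 1)
    let wt : ℤ → Fin (k + 1) → ℝ := fun x => Fin.snoc (fun _ => 1) (b x)⁻¹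
    refine MinorsNonneg.of_tendsto (l := Filter.atBot)
      (F := fun x u c => wt x u * hurwitz a b (row x u) (d + (c : ℕ))) ?_ ?_
    · filter_upwards [Filter.eventually_le_atBot K, Filter.eventually_le_atBot (d - |e|)]
        with x hx hx'
      refine hH'.mul_comp (f := row x) (g := fun c : ℕ => d + (c : ℤ)) ?_
        (fun _ _ h => by simpa using h) ?_
      · intro u v huv
        induction v using Fin.lastCases with
        | last =>
          induction u using Fin.lastCases with
          | last => exact absurd huv (lt_irrefl _)
          | cast u =>
            have h1 : i u ≤ e := he ⟨u, rfl⟩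
            have h2 := le_abs_self e
            have h3 := abs_nonneg e
            simp only [row, Fin.snoc_castSucc, Fin.snoc_last]
            omega
        | cast v =>
          induction u using Fin.lastCases with
          | last => exact absurd huv (not_lt.2 (Fin.le_last _))
          | cast u => simpa [row] using hi (by simpa using huv)
      · intro u
        induction u using Fin.lastCases with
        | last => simpa [wt] using (hK x hx).le
        | cast u => simp [wt]
    · intro u c
      induction u using Fin.lastCases with
      | last =>
        simp only [A, row, wt, Fin.snoc_last, hurwitz_odd]
        refine (tendsto_div_atBot_of_ratio hK hr hlim c).congr fun x => ?_
        rw [div_eq_inv_mul]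
        congr 2
        ring
      | cast u => simp [A, row, wt]
  have hA' := hA.sub_mul_succ (r := r)
    (fun q => by
      rw [Fin.top_eq_last]
      simp only [A, Fin.snoc_last]
      rw [pow_succ]
      field_simp)
    (fun q => by
      rw [Fin.top_eq_last]
      simp only [A, Fin.snoc_last]
      positivity)
  have hdj (s : Fin k) : d ≤ j s := hd ⟨s, rfl⟩
  have h := hA' k Fin.castSucc (fun s => (j s - d).toNat) (Fin.strictMono_castSucc) fun s t hst => by
    have h1 := hj hst
    have h2 := hdj s
    dsimp only
    omega
  convert h using 3
  ext u s
  have h1 : (((j s - d).toNat : ℕ) : ℤ) = j s - d := Int.toNat_of_nonneg (by linarith [hdj s])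
  simp [A, hurwitz_sub_mul, h1, ← add_assoc]
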